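/- Let ρ be a probability measure on ℝ, not the Dirac mass at 0, such that ∫_ℝ exp(v₀ z²) dρ(z) < +∞ for some v₀ > 0, and let σ² denote its variance (assume ρ is symmetric). Then, under the measures μ̃_{n,ρ}, the random variable Tₙ/n converges in probability to σ² as n → ∞. -/

import Mathlib

open MeasureTheory Filter Topology Real

/-- `Sₙ(x) = x₁ + ⋯ + xₙ`. -/
noncomputable def S (n : ℕ) (x : Fin n → ℝ) : ℝ := ∑ i, x i

/-- `Tₙ(x) = x₁² + ⋯ + xₙ²`. -/
noncomputable def T (n : ℕ) (x : Fin n → ℝ) : ℝ := ∑ i, (x i) ^ 2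

/-- The (unnormalized) density `exp((1/2) Sₙ²/Tₙ) 1{Tₙ > 0}` of the Curie-Weiss model
of SOC with respect to `ρ^⊗n`. -/
noncomputable def weight (n : ℕ) (x : Fin n → ℝ) : ℝ :=
  if 0 < T n x then Real.exp (S n x ^ 2 / (2 * T n x)) else 0

/-- The normalization constant `Zₙ`. -/
noncomputable def Z (ρ : Measure ℝ) (n : ℕ) : ℝ :=
  ∫ x, weight n x ∂(Measure.pi fun _ : Fin n => ρ)

/-- The measure `μ̃_{n,ρ}` on `ℝⁿ` with density `(1/Zₙ) exp((1/2) Sₙ²/Tₙ) 1{Tₙ > 0}`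
with respect to `ρ^⊗n`. -/
noncomputable def tildeMu (ρ : Measure ℝ) (n : ℕ) : Measure (Fin n → ℝ) :=
  (ENNReal.ofReal (Z ρ n))⁻¹ •
    (Measure.pi fun _ : Fin n => ρ).withDensity fun x => ENNReal.ofReal (weight n x)

open ProbabilityTheory

lemma measurable_S (n : ℕ) : Measurable (S n) := by
  unfold S; fun_prop

lemma measurable_T (n : ℕ) : Measurable (T n) := by
  unfold T; fun_prop

lemma measurable_weight (n : ℕ) : Measurable (weight n) := by
  unfold weight
  exact Measurable.ite (measurableSet_lt measurable_const (measurable_T n))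
    (((measurable_S n).pow_const 2).div ((measurable_T n).const_mul 2)).exp measurable_const

lemma S_sq_le (n : ℕ) (x : Fin n → ℝ) : S n x ^ 2 ≤ n * T n x := by
  simpa [S, T] using sq_sum_le_card_mul_sum_sq (s := Finset.univ) (f := x)

lemma T_nonneg (n : ℕ) (x : Fin n → ℝ) : 0 ≤ T n x :=
  Finset.sum_nonneg fun _ _ => sq_nonneg _

lemma weight_nonneg (n : ℕ) (x : Fin n → ℝ) : 0 ≤ weight n x := by
  unfold weight; split_ifs <;> positivity

lemma weight_le (n : ℕ) (x : Fin n → ℝ) : weight n x ≤ exp (n / 2) := by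
  unfold weight
  split_ifs with h
  · rw [exp_le_exp, div_le_div_iff₀ (by positivity) two_pos]
    nlinarith [S_sq_le n x]
  · positivity

lemma integrable_weight (ρ : Measure ℝ) [IsProbabilityMeasure ρ] (n : ℕ) :
    Integrable (weight n) (Measure.pi fun _ : Fin n => ρ) :=
  Integrable.of_bound (measurable_weight n).aestronglyMeasurable (exp (n / 2))
    (ae_of_all _ fun x => by
      rw [norm_of_nonneg (weight_nonneg n x)]; exact weight_le n x)

/-- The normalization constants are bounded below by `ρ {0}ᶜ`. -/
lemma measure_compl_zero_le_Z (ρ : Measure ℝ) [IsProbabilityMeasure ρ] {n : ℕ} (hn : 0 < n) :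
    ρ {0}ᶜ ≤ ENNReal.ofReal (Z ρ n) := by
  let i : Fin n := ⟨0, hn⟩
  rw [Z, ofReal_integral_eq_lintegral_ofReal (integrable_weight ρ n)
    (ae_of_all _ (weight_nonneg n)),
    ← (measurePreserving_eval (fun _ : Fin n => ρ) i).measure_preimage
      (measurableSet_singleton 0).compl.nullMeasurableSet,
    ← lintegral_indicator_one ((measurable_pi_apply i) (measurableSet_singleton 0).compl)]
  refine lintegral_mono fun x => ?_
  by_cases hx : x i = 0
  · simp [hx]
  rw [Set.indicator_of_mem (by simpa using hx)]
  have hT : 0 < T n x :=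
    Finset.sum_pos' (fun _ _ => sq_nonneg _) ⟨i, Finset.mem_univ _, by positivity⟩
  rw [weight, if_pos hT]
  simp only [Pi.one_apply, ENNReal.one_le_ofReal, one_le_exp_iff]
  positivity

/-- The sign attached to a Boolean. -/
def boolSign (b : Bool) : ℝ := if b then 1 else -1

lemma boolSign_sq (b : Bool) : boolSign b ^ 2 = 1 := by
  cases b <;> simp [boolSign]

/-- Averaging `exp` of a linear form over all sign changes gives a product of `cosh`. -/
lemma sum_exp_boolSign_le (n : ℕ) (y : Fin n → ℝ) :
    ∑ e : Fin n → Bool, exp (∑ i, boolSign (e i) * y i) ≤ 2 ^ n * exp ((∑ i, y i ^ 2) / 2) := by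
  have h : ∑ e : Fin n → Bool, exp (∑ i, boolSign (e i) * y i) = ∏ i, (2 * cosh (y i)) := by
    simp_rw [exp_sum]
    rw [← Fintype.piFinset_univ, ← Finset.prod_univ_sum (fun _ => Finset.univ)
      (fun i b => exp (boolSign b * y i))]
    refine Finset.prod_congr rfl fun i _ => ?_
    simp [boolSign, cosh_eq]
    ring
  rw [h, Finset.prod_mul_distrib, Finset.sum_div, exp_sum]
  simp only [Finset.prod_const, Finset.card_univ, Fintype.card_fin]
  gcongr with i
  exact cosh_le_exp_half_sq _

lemma measurePreserving_boolSign_mul {ρ : Measure ℝ} [IsProbabilityMeasure ρ]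
    (hsymm : ρ.map (fun x => -x) = ρ) {n : ℕ} (e : Fin n → Bool) :
    MeasurePreserving (fun (x : Fin n → ℝ) i => boolSign (e i) * x i)
      (Measure.pi fun _ => ρ) (Measure.pi fun _ => ρ) := by
  refine measurePreserving_pi (f := fun i x => boolSign (e i) * x) _ _ fun i => ?_
  cases e i
  · simpa [boolSign] using (⟨measurable_neg, hsymm⟩ : MeasurePreserving (fun x : ℝ => -x) ρ ρ)
  · simpa [boolSign] using! MeasurePreserving.id ρ

/-- Self-normalized sums of symmetric variables are sub-Gaussian on events which depend only on
`Tₙ`. -/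
lemma lintegral_exp_mul_S_div_sqrt_T_le {ρ : Measure ℝ} [IsProbabilityMeasure ρ]
    (hsymm : ρ.map (fun x => -x) = ρ) (n : ℕ) {B : Set ℝ} (hB : MeasurableSet B) (t : ℝ) :
    ∫⁻ x in T n ⁻¹' B, ENNReal.ofReal (exp (t * (S n x / √(T n x))))
        ∂(Measure.pi fun _ : Fin n => ρ)
      ≤ ENNReal.ofReal (exp (t ^ 2 / 2)) * (Measure.pi fun _ : Fin n => ρ) (T n ⁻¹' B) := by
  set μ := Measure.pi fun _ : Fin n => ρ
  have hA : MeasurableSet (T n ⁻¹' B) := measurable_T n hB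
  have hm : Measurable fun x => ENNReal.ofReal (exp (t * (S n x / √(T n x)))) :=
    (((measurable_S n).div (measurable_T n).sqrt).const_mul t).exp.ennreal_ofReal
  have hT (e : Fin n → Bool) (x : Fin n → ℝ) : T n (fun i => boolSign (e i) * x i) = T n x := by
    simp [T, mul_pow, boolSign_sq]
  have hflip (e : Fin n → Bool) :
      ∫⁻ x in T n ⁻¹' B, ENNReal.ofReal (exp (t * (S n x / √(T n x)))) ∂μ =
        ∫⁻ x in T n ⁻¹' B,
          ENNReal.ofReal (exp (∑ i, boolSign (e i) * (t * (x i / √(T n x))))) ∂μ := by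
    rw [← (measurePreserving_boolSign_mul hsymm e).setLIntegral_comp_preimage hA hm]
    have : (fun (x : Fin n → ℝ) i => boolSign (e i) * x i) ⁻¹' (T n ⁻¹' B) = T n ⁻¹' B := by
      ext x; simp [hT]
    rw [this]
    refine lintegral_congr fun x => ?_
    rw [hT, S, Finset.sum_div, Finset.mul_sum]
    congr 3 with i
    ring
  have hsum (x : Fin n → ℝ) :
      ∑ e : Fin n → Bool,
        ENNReal.ofReal (exp (∑ i, boolSign (e i) * (t * (x i / √(T n x))))) ≤
        2 ^ n * ENNReal.ofReal (exp (t ^ 2 / 2)) := by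
    rw [← ENNReal.ofReal_sum_of_nonneg fun _ _ => (exp_pos _).le]
    have h2 : (2 : ENNReal) ^ n = ENNReal.ofReal (2 ^ n) := by
      rw [ENNReal.ofReal_pow two_pos.le, ENNReal.ofReal_ofNat]
    rw [h2, ← ENNReal.ofReal_mul (by positivity)]
    refine ENNReal.ofReal_le_ofReal ((sum_exp_boolSign_le n _).trans ?_)
    gcongr
    simp_rw [mul_pow, div_pow, sq_sqrt (T_nonneg n x)]
    rw [← Finset.mul_sum, ← Finset.sum_div]
    exact mul_le_of_le_one_right (sq_nonneg t) (div_self_le_one (T n x))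
  have key : (2 : ENNReal) ^ n *
      ∫⁻ x in T n ⁻¹' B, ENNReal.ofReal (exp (t * (S n x / √(T n x)))) ∂μ ≤
      2 ^ n * (ENNReal.ofReal (exp (t ^ 2 / 2)) * μ (T n ⁻¹' B)) := by
    calc _ = ∑ e : Fin n → Bool, ∫⁻ x in T n ⁻¹' B,
          ENNReal.ofReal (exp (∑ i, boolSign (e i) * (t * (x i / √(T n x))))) ∂μ := by
            rw [← Finset.sum_congr rfl fun e _ => hflip e]
            simp
      _ = ∫⁻ x in T n ⁻¹' B, ∑ e : Fin n → Bool,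
          ENNReal.ofReal (exp (∑ i, boolSign (e i) * (t * (x i / √(T n x))))) ∂μ := by
            refine (lintegral_finsetSum _ fun e _ => ?_).symm
            have := measurable_T n
            fun_prop
      _ ≤ ∫⁻ x in T n ⁻¹' B, 2 ^ n * ENNReal.ofReal (exp (t ^ 2 / 2)) ∂μ :=
            lintegral_mono fun x => hsum x
      _ = _ := by rw [setLIntegral_const, mul_assoc]
  exact (ENNReal.mul_le_mul_iff_right (by simp) (by simp)).1 key

lemma lintegral_exp_mul_gaussianReal (v : NNReal) (s : ℝ) :
    ∫⁻ t, ENNReal.ofReal (exp (t * s)) ∂(gaussianReal 0 v) =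
      ENNReal.ofReal (exp (v * s ^ 2 / 2)) := by
  simp_rw [mul_comm _ s]
  rw [← ofReal_integral_eq_lintegral_ofReal (integrable_exp_mul_gaussianReal s)
    (ae_of_all _ fun _ => (exp_pos _).le)]
  have := congrFun (mgf_id_gaussianReal (μ := 0) (v := v)) s
  simp only [mgf, id, zero_mul, zero_add] at this
  rw [this]

lemma lintegral_exp_half_sq_gaussianReal {v : NNReal} (h0 : 0 < v) (h1 : v < 1) :
    ∫⁻ t, ENNReal.ofReal (exp (t ^ 2 / 2)) ∂(gaussianReal 0 v) =
      ENNReal.ofReal (√(1 - v))⁻¹ := by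
  have h0' : (0 : ℝ) < v := h0
  have h1' : (v : ℝ) < 1 := h1
  have hb : 0 < (1 - v : ℝ) / (2 * v) := div_pos (by linarith) (by linarith)
  rw [gaussianReal_of_var_ne_zero _ h0.ne',
    lintegral_withDensity_eq_lintegral_mul _ (measurable_gaussianPDF _ _) (by fun_prop)]
  have h (t : ℝ) : (gaussianPDF 0 v * fun t => ENNReal.ofReal (exp (t ^ 2 / 2))) t =
      ENNReal.ofReal ((√(2 * π * v))⁻¹ * exp (-((1 - v : ℝ) / (2 * v)) * t ^ 2)) := by
    rw [Pi.mul_apply, gaussianPDF, ← ENNReal.ofReal_mul (gaussianPDFReal_nonneg _ _ _),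
      gaussianPDFReal, mul_assoc, ← exp_add]
    congr 3
    field_simp
    ring
  simp_rw [h]
  rw [← ofReal_integral_eq_lintegral_ofReal ((integrable_exp_neg_mul_sq hb).const_mul _)
    (ae_of_all _ fun _ => by positivity), integral_const_mul, integral_gaussian]
  have : π / ((1 - v : ℝ) / (2 * v)) = (2 * π * v) / (1 - v) := by
    field_simp
  rw [this, sqrt_div (by positivity)]
  have : √(2 * π * v) ≠ 0 := by positivity
  field_simp

/-- On events which depend only on `Tₙ`, the density costs at most a factor of order `√n`. -/
lemma lintegral_weight_le {ρ : Measure ℝ} [IsProbabilityMeasure ρ]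
    (hsymm : ρ.map (fun x => -x) = ρ) {n : ℕ} (hn : 0 < n) {B : Set ℝ} (hB : MeasurableSet B) :
    ∫⁻ x in T n ⁻¹' B, ENNReal.ofReal (weight n x) ∂(Measure.pi fun _ : Fin n => ρ) ≤
      ENNReal.ofReal (exp (1 / 2) * √(n + 1)) *
        (Measure.pi fun _ : Fin n => ρ) (T n ⁻¹' B) := by
  set μ := Measure.pi fun _ : Fin n => ρ
  have hn' : (0 : ℝ) < n := by exact_mod_cast hn
  let v : NNReal := n / (n + 1)
  have hv : (v : ℝ) = n / (n + 1) := by simp [v]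
  have hv0 : 0 < v := by
    rw [← NNReal.coe_pos, hv]; positivity
  have hv1 : v < 1 := by
    rw [← NNReal.coe_lt_coe, hv, NNReal.coe_one, div_lt_one (by positivity)]; linarith
  have hw (x : Fin n → ℝ) : ENNReal.ofReal (weight n x) ≤
      ENNReal.ofReal (exp (1 / 2)) * ∫⁻ t, ENNReal.ofReal (exp (t * (S n x / √(T n x))))
        ∂(gaussianReal 0 v) := by
    rw [lintegral_exp_mul_gaussianReal, ← ENNReal.ofReal_mul (by positivity), ← exp_add]
    refine ENNReal.ofReal_le_ofReal ?_
    unfold weight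
    split_ifs with hT
    · rw [exp_le_exp, div_pow, sq_sqrt hT.le, hv]
      have h : S n x ^ 2 / T n x ≤ n := (div_le_iff₀ hT).2 (S_sq_le n x)
      have h' : S n x ^ 2 / (2 * T n x) = S n x ^ 2 / T n x / 2 := by
        field_simp
      rw [h']
      generalize S n x ^ 2 / T n x = q at h
      have : 1 / 2 + (n : ℝ) / (n + 1) * q / 2 - q / 2 = (n + 1 - q) / (2 * (n + 1)) := by
        field_simp
        ring
      have : 0 ≤ (n + 1 - q) / (2 * ((n : ℝ) + 1)) := div_nonneg (by linarith) (by positivity)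
      linarith
    · positivity
  have hm : Measurable (Function.uncurry fun (x : Fin n → ℝ) (t : ℝ) =>
      ENNReal.ofReal (exp (t * (S n x / √(T n x))))) := by
    have := measurable_T n
    have := measurable_S n
    unfold Function.uncurry
    fun_prop
  calc _ ≤ ∫⁻ x in T n ⁻¹' B, ENNReal.ofReal (exp (1 / 2)) *
          ∫⁻ t, ENNReal.ofReal (exp (t * (S n x / √(T n x)))) ∂(gaussianReal 0 v) ∂μ :=
        lintegral_mono hw
    _ = ENNReal.ofReal (exp (1 / 2)) * ∫⁻ t, ∫⁻ x in T n ⁻¹' B,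
          ENNReal.ofReal (exp (t * (S n x / √(T n x)))) ∂μ ∂(gaussianReal 0 v) := by
        rw [lintegral_const_mul _ hm.lintegral_prod_right, lintegral_lintegral_swap hm.aemeasurable]
    _ ≤ ENNReal.ofReal (exp (1 / 2)) * ∫⁻ t, ENNReal.ofReal (exp (t ^ 2 / 2)) *
          μ (T n ⁻¹' B) ∂(gaussianReal 0 v) := by
        gcongr with t
        exact lintegral_exp_mul_S_div_sqrt_T_le hsymm n hB t
    _ = _ := by
        rw [lintegral_mul_const _ (by fun_prop), lintegral_exp_half_sq_gaussianReal hv0 hv1,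
          ENNReal.ofReal_mul (by positivity), mul_assoc, ← sqrt_inv, hv]
        congr 4
        field_simp
        ring

lemma memLp_sq_of_integrable_exp_mul_sq {ρ : Measure ℝ} {v : ℝ} (hv : 0 < v)
    (h : Integrable (fun z : ℝ => exp (v * z ^ 2)) ρ) :
    MemLp (fun z : ℝ => z ^ 2) 2 ρ := by
  rw [memLp_two_iff_integrable_sq (by fun_prop)]
  refine (h.const_mul (2 / v ^ 2)).mono' (by fun_prop) (ae_of_all _ fun z => ?_)
  rw [norm_of_nonneg (by positivity), div_mul_eq_mul_div, le_div_iff₀ (by positivity)]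
  have h0 : 0 ≤ v * z ^ 2 := by positivity
  nlinarith [quadratic_le_exp_of_nonneg h0]

lemma integral_id_eq_zero_of_map_neg {ρ : Measure ℝ} (hsymm : ρ.map (fun x => -x) = ρ) :
    ∫ x, x ∂ρ = 0 := by
  have h : ∫ x, x ∂ρ = ∫ x, -x ∂ρ := by
    conv_lhs => rw [← hsymm]
    exact integral_map measurable_neg.aemeasurable (by fun_prop)
  rw [integral_neg] at h
  linarith

/-- Chebyshev's inequality for `Tₙ / n` under `ρ^⊗n`. -/
lemma measure_le_abs_T_div_sub_le {ρ : Measure ℝ} [IsProbabilityMeasure ρ]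
    (h : MemLp (fun z : ℝ => z ^ 2) 2 ρ) {n : ℕ} (hn : 0 < n) {ε : ℝ} (hε : 0 < ε) :
    (Measure.pi fun _ : Fin n => ρ) {x | ε ≤ |T n x / n - ∫ z, z ^ 2 ∂ρ|} ≤
      ENNReal.ofReal (Var[fun z : ℝ => z ^ 2; ρ] / (n * ε ^ 2)) := by
  set μ := Measure.pi fun _ : Fin n => ρ
  have hn' : (0 : ℝ) < n := by exact_mod_cast hn
  have hi (i : Fin n) : MemLp (fun x : Fin n → ℝ => x i ^ 2) 2 μ :=
    h.comp_measurePreserving (measurePreserving_eval (fun _ : Fin n => ρ) i)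
  have hT : T n = ∑ i, fun x : Fin n → ℝ => x i ^ 2 := by
    ext x; simp [T]
  have hLp : MemLp (T n) 2 μ := by
    rw [hT]; exact memLp_finsetSum' _ fun i _ => hi i
  have hint : ∫ x, T n x ∂μ = n * ∫ z, z ^ 2 ∂ρ := by
    unfold T
    rw [integral_finsetSum _ fun i _ => (hi i).integrable one_le_two]
    have (i : Fin n) : ∫ x : Fin n → ℝ, x i ^ 2 ∂μ = ∫ z, z ^ 2 ∂ρ :=
      integral_comp_eval (μ := fun _ : Fin n => ρ) (f := fun z : ℝ => z ^ 2) (by fun_prop)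
    simp [this]
  have hvar : Var[T n; μ] = n * Var[fun z : ℝ => z ^ 2; ρ] := by
    rw [hT]
    simpa using variance_sum_pi (μ := fun _ : Fin n => ρ) (X := fun _ z => z ^ 2) fun _ => h
  have hset : {x | ε ≤ |T n x / n - ∫ z, z ^ 2 ∂ρ|} =
      {x | n * ε ≤ |T n x - ∫ x, T n x ∂μ|} := by
    ext x
    have : T n x - n * ∫ z, z ^ 2 ∂ρ = n * (T n x / n - ∫ z, z ^ 2 ∂ρ) := by
      field_simp
    rw [Set.mem_ofPred_eq, Set.mem_ofPred_eq, hint, this, abs_mul, abs_of_pos hn',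
      mul_le_mul_iff_right₀ hn']
  rw [hset]
  refine (meas_ge_le_variance_div_sq hLp (by positivity)).trans (ENNReal.ofReal_le_ofReal ?_)
  rw [hvar]
  apply le_of_eq
  field_simp

lemma measure_compl_zero_ne_zero {ρ : Measure ℝ} [IsProbabilityMeasure ρ]
    (hne : ρ ≠ Measure.dirac 0) : ρ {0}ᶜ ≠ 0 := by
  intro h
  apply hne
  have h1 : ρ {0} = 1 := (prob_compl_eq_zero_iff (measurableSet_singleton 0)).1 h
  have h2 : ρ.restrict {0} = ρ := Measure.restrict_eq_self_of_ae_mem (mem_ae_iff.2 h)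
  rw [← h2, Measure.restrict_singleton, h1, one_smul]

/-- if `ρ` is a symmetric probability measure on `ℝ`, not the Dirac mass
at `0`, with `∫ exp(v₀ z²) dρ(z) < ∞` for some `v₀ > 0`, and with variance `σ²`, then
under `μ̃_{n,ρ}` the random variable `Tₙ/n` converges in probability to `σ²`. -/
theorem Tn_div_n_tendsto_in_probability
    (ρ : Measure ℝ) [IsProbabilityMeasure ρ]
    (hsymm : ρ.map (fun x => -x) = ρ)
    (hne : ρ ≠ Measure.dirac 0)
    (hexp : ∃ v₀ : ℝ, 0 < v₀ ∧ Integrable (fun z : ℝ => Real.exp (v₀ * z ^ 2)) ρ)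
    (σ2 : ℝ) (hσ2 : σ2 = ProbabilityTheory.variance id ρ) :
    ∀ ε : ℝ, 0 < ε →
      Tendsto (fun n : ℕ => tildeMu ρ n {x | ε ≤ |T n x / (n : ℝ) - σ2|})
        atTop (𝓝 0) := by
  intro ε hε
  obtain ⟨v, hv, hint⟩ := hexp
  have hLp := memLp_sq_of_integrable_exp_mul_sq hv hint
  have hσ : σ2 = ∫ z, z ^ 2 ∂ρ := by
    rw [hσ2, variance_of_integral_eq_zero aemeasurable_id (integral_id_eq_zero_of_map_neg hsymm)]
    rfl
  have hc := measure_compl_zero_ne_zero hne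
  set V := Var[fun z : ℝ => z ^ 2; ρ]
  have hbound (n : ℕ) (hn : 0 < n) :
      tildeMu ρ n {x | ε ≤ |T n x / (n : ℝ) - σ2|} ≤ (ρ {0}ᶜ)⁻¹ *
        ENNReal.ofReal (exp (1 / 2) * √(n + 1) * (V / (n * ε ^ 2))) := by
    let B : Set ℝ := {y | ε ≤ |y / n - σ2|}
    have hB : MeasurableSet B := measurableSet_le measurable_const (by fun_prop)
    change tildeMu ρ n (T n ⁻¹' B) ≤ _
    rw [tildeMu, Measure.smul_apply, withDensity_apply _ (measurable_T n hB), smul_eq_mul]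
    refine mul_le_mul' (ENNReal.inv_le_inv.2 (measure_compl_zero_le_Z ρ hn)) ?_
    refine (lintegral_weight_le hsymm hn hB).trans ?_
    rw [ENNReal.ofReal_mul (p := exp (1 / 2) * √((n : ℝ) + 1)) (by positivity)]
    gcongr
    have := measure_le_abs_T_div_sub_le hLp hn hε
    rwa [← hσ] at this
  have hlim : Tendsto (fun n : ℕ => exp (1 / 2) * √((n : ℝ) + 1) * (V / (n * ε ^ 2)))
      atTop (𝓝 0) := by
    have hcast := tendsto_natCast_atTop_atTop (R := ℝ)
    have h1 : Tendsto (fun n : ℕ => √(((n : ℝ) + 1) / n * (1 / n))) atTop (𝓝 0) := by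
      have h := (tendsto_natCast_div_add_atTop (1 : ℝ)).inv₀ one_ne_zero
      simp only [inv_div] at h
      simpa using (h.mul tendsto_one_div_atTop_nhds_zero_nat).sqrt
    have h2 := h1.const_mul (exp (1 / 2) * (V / ε ^ 2))
    rw [mul_zero] at h2
    refine h2.congr' ?_
    filter_upwards [eventually_gt_atTop 0] with n hn
    have hn' : (0 : ℝ) < n := by exact_mod_cast hn
    have : ((n : ℝ) + 1) / n * (1 / n) = (n + 1) / n ^ 2 := by
      field_simp
    rw [this, sqrt_div (by positivity), sqrt_sq hn'.le]
    field_simp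
  have hlim' : Tendsto (fun n : ℕ => (ρ {0}ᶜ)⁻¹ *
      ENNReal.ofReal (exp (1 / 2) * √((n : ℝ) + 1) * (V / (n * ε ^ 2)))) atTop (𝓝 0) := by
    simpa using ENNReal.Tendsto.const_mul (ENNReal.tendsto_ofReal hlim)
      (Or.inr (ENNReal.inv_ne_top.2 hc))
  exact tendsto_of_tendsto_of_tendsto_of_le_of_le' tendsto_const_nhds hlim'
    (Eventually.of_forall fun _ => zero_le)
    (by filter_upwards [eventually_gt_atTop 0] with n hn using hbound n hn)
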